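/- Let N > 1, let a < 0 < b be real numbers, and let w : (a,b) → [0,∞) be a continuous integrable function with w(0) > 0 such that x ↦ w(x)^{1/(N-1)} is concave on (a,b), ∫_a^b w(x) dx = 1, and ∫_a^b x·w(x) dx = 0. Define R : ℝ → [0,1] by R(x) := ∫_a^{min(x,b)} w(s) ds for x > a and R(x) := 0 for x ≤ a, set c := w(0)/R(0), and define F : ℝ → [0,1] by F(x) := (N/(N+1))^N·(1 + (c/N)·x)^N for x ∈ [−N/c, 1/c], F(x) := 0 for x < −N/c, and F(x) := 1 for x > 1/c. If R(0) ≤ (1+ε)·(N/(N+1))^N for some ε > 0, then ∫_ℝ |R(x) − F(x)| dx ≤ (4√3·N^{N+1}/(N+1)^N)·(1+ε)·(1 − (1+ε)^{−1/N})·(∫_a^b x²·w(x) dx)^{1/2}. -/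

import Mathlib

open MeasureTheory

theorem nonneg_of_hasDerivAt_nonneg {f f' : ℝ → ℝ} (h0 : f 0 = 0)
    (hd : ∀ x, HasDerivAt f (f' x) x) (hf' : ∀ x, 0 ≤ x → 0 ≤ f' x) :
    ∀ x, 0 ≤ x → 0 ≤ f x := by
  intro x hx
  have hm : MonotoneOn f (Set.Ici 0) := by
    refine monotoneOn_of_deriv_nonneg (convex_Ici 0)
      (fun y _ => (hd y).continuousAt.continuousWithinAt)
      (fun y _ => (hd y).differentiableAt.differentiableWithinAt) ?_
    intro y hy
    rw [interior_Ici] at hy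
    rw [(hd y).deriv]
    exact hf' y (le_of_lt hy)
  have := hm (Set.mem_Ici.2 le_rfl) (Set.mem_Ici.2 hx) hx
  rwa [h0] at this

theorem sinh_le_mul_cosh {x : ℝ} (hx : 0 ≤ x) : Real.sinh x ≤ x * Real.cosh x := by
  have := nonneg_of_hasDerivAt_nonneg (f := fun x => x * Real.cosh x - Real.sinh x)
    (f' := fun x => x * Real.sinh x) (by simp)
    (fun x =>
      (((hasDerivAt_id' x).mul (Real.hasDerivAt_cosh x)).sub (Real.hasDerivAt_sinh x)).congr_deriv
        (by ring))
    (fun x hx => mul_nonneg hx (Real.sinh_nonneg_iff.2 hx)) x hx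
  linarith

theorem add_cube_div_six_le_sinh {x : ℝ} (hx : 0 ≤ x) : x + x ^ 3 / 6 ≤ Real.sinh x := by
  have h1 := nonneg_of_hasDerivAt_nonneg (f := fun x => Real.cosh x - 1 - x ^ 2 / 2)
    (f' := fun x => Real.sinh x - x) (by simp)
    (fun x =>
      (((Real.hasDerivAt_cosh x).sub_const 1).sub ((hasDerivAt_pow 2 x).div_const 2)).congr_deriv
        (by norm_num))
    (fun x hx => sub_nonneg.2 (Real.self_le_sinh_iff.2 hx))
  have := nonneg_of_hasDerivAt_nonneg (f := fun x => Real.sinh x - x - x ^ 3 / 6)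
    (f' := fun x => Real.cosh x - 1 - x ^ 2 / 2) (by simp)
    (fun x =>
      (((Real.hasDerivAt_sinh x).sub (hasDerivAt_id' x)).sub
        ((hasDerivAt_pow 3 x).div_const 6)).congr_deriv
        (by norm_num; ring)) h1 x hx
  linarith

theorem four_mul_cosh_sub_one_le {x : ℝ} (hx : 0 ≤ x) :
    4 * (Real.cosh x - 1) ≤ x * Real.sinh x + x ^ 2 := by
  have h2 := nonneg_of_hasDerivAt_nonneg (f := fun x => x * Real.sinh x + 2 - 2 * Real.cosh x)
    (f' := fun x => x * Real.cosh x - Real.sinh x) (by simp)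
    (fun x =>
      ((((hasDerivAt_id' x).mul (Real.hasDerivAt_sinh x)).add_const 2).sub
        ((Real.hasDerivAt_cosh x).const_mul 2)).congr_deriv
        (by ring))
    (fun x hx => sub_nonneg.2 (sinh_le_mul_cosh hx))
  have h1 := nonneg_of_hasDerivAt_nonneg
    (f := fun x => x * Real.cosh x + 2 * x - 3 * Real.sinh x)
    (f' := fun x => x * Real.sinh x + 2 - 2 * Real.cosh x) (by simp)
    (fun x =>
      ((((hasDerivAt_id' x).mul (Real.hasDerivAt_cosh x)).add
        ((hasDerivAt_id' x).const_mul 2)).sub ((Real.hasDerivAt_sinh x).const_mul 3)).congr_deriv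
        (by ring)) h2
  have := nonneg_of_hasDerivAt_nonneg
    (f := fun x => x * Real.sinh x + x ^ 2 - 4 * (Real.cosh x - 1))
    (f' := fun x => x * Real.cosh x + 2 * x - 3 * Real.sinh x) (by simp)
    (fun x =>
      ((((hasDerivAt_id' x).mul (Real.hasDerivAt_sinh x)).add
        (hasDerivAt_pow 2 x)).sub (((Real.hasDerivAt_cosh x).sub_const 1).const_mul 4)).congr_deriv
        (by norm_num; ring)) h1 x hx
  linarith

theorem two_mul_sinh_sq_le {u : ℝ} (hu : 0 ≤ u) :
    2 * Real.sinh u ^ 2 ≤ u * Real.sinh u * Real.cosh u + u ^ 2 := by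
  have h := four_mul_cosh_sub_one_le (x := 2 * u) (by positivity)
  rw [Real.cosh_two_mul, Real.sinh_two_mul, Real.cosh_sq] at h
  nlinarith

theorem sq_lt_sinh_sq {u : ℝ} (hu : 0 < u) : u ^ 2 < Real.sinh u ^ 2 :=
  pow_lt_pow_left₀ (Real.self_lt_sinh_iff.2 hu) hu.le two_ne_zero

/-- The product of the variance and the squared density at the mean, for an exponential density
truncated to an interval, is at least `1 / 12`. -/
theorem sinh_pow_four_le {u : ℝ} (hu : 0 < u) :
    Real.sinh u ^ 4 ≤ 3 * (Real.sinh u ^ 2 - u ^ 2) *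
      Real.exp (2 * (u * Real.cosh u / Real.sinh u - 1)) := by
  set D : ℝ → ℝ := fun u => Real.log (Real.sinh u ^ 2 - u ^ 2) +
    2 * (u * Real.cosh u / Real.sinh u - 1) - 4 * Real.log (Real.sinh u) with hD
  have hder : ∀ x, 0 < x → HasDerivAt D
      ((2 * Real.sinh x * Real.cosh x - 2 * x) / (Real.sinh x ^ 2 - x ^ 2) +
        2 * (((Real.cosh x + x * Real.sinh x) * Real.sinh x - x * Real.cosh x * Real.cosh x) /
          Real.sinh x ^ 2) - 4 * (Real.cosh x / Real.sinh x)) x := by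
    intro x hx
    have hs : 0 < Real.sinh x := Real.sinh_pos_iff.2 hx
    have hq := sq_lt_sinh_sq hx
    have e1 : HasDerivAt (fun x => Real.sinh x ^ 2 - x ^ 2)
        (2 * Real.sinh x * Real.cosh x - 2 * x) x := by
      exact (((Real.hasDerivAt_sinh x).pow 2).sub (hasDerivAt_pow 2 x)).congr_deriv (by norm_num)
    have e2 : HasDerivAt (fun x => x * Real.cosh x / Real.sinh x)
        (((Real.cosh x + x * Real.sinh x) * Real.sinh x - x * Real.cosh x * Real.cosh x) /
          Real.sinh x ^ 2) x := by
      exact (((hasDerivAt_id' x).mul (Real.hasDerivAt_cosh x)).div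
        (Real.hasDerivAt_sinh x) hs.ne').congr_deriv (by simp)
    exact ((e1.log (by linarith)).add ((e2.sub_const 1).const_mul 2)).sub
      (((Real.hasDerivAt_sinh x).log hs.ne').const_mul 4)
  have hmono : MonotoneOn D (Set.Ioi 0) := by
    refine monotoneOn_of_deriv_nonneg (convex_Ioi 0)
      (fun y hy => (hder y hy).continuousAt.continuousWithinAt)
      (fun y hy => (hder y (interior_subset hy)).differentiableAt.differentiableWithinAt) ?_
    intro x hx
    have hx : 0 < x := interior_subset hx
    rw [(hder x hx).deriv]
    have hs : 0 < Real.sinh x := Real.sinh_pos_iff.2 hx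
    have hq : 0 < Real.sinh x ^ 2 - x ^ 2 := sub_pos.2 (sq_lt_sinh_sq hx)
    have key := two_mul_sinh_sq_le hx.le
    have hcs : Real.cosh x ^ 2 = Real.sinh x ^ 2 + 1 := Real.cosh_sq x
    have : (2 * Real.sinh x * Real.cosh x - 2 * x) / (Real.sinh x ^ 2 - x ^ 2) +
        2 * (((Real.cosh x + x * Real.sinh x) * Real.sinh x - x * Real.cosh x * Real.cosh x) /
          Real.sinh x ^ 2) - 4 * (Real.cosh x / Real.sinh x) =
        2 * x * (x * Real.sinh x * Real.cosh x + x ^ 2 - 2 * Real.sinh x ^ 2) /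
          ((Real.sinh x ^ 2 - x ^ 2) * Real.sinh x ^ 2) := by
      field_simp
      linear_combination (2 * x ^ 3 - 2 * x * Real.sinh x ^ 2) * hcs
    rw [this]
    have : 0 ≤ x * Real.sinh x * Real.cosh x + x ^ 2 - 2 * Real.sinh x ^ 2 := by linarith
    positivity
  have hexp : ∀ x, 0 < x → Real.exp (D x) = (Real.sinh x ^ 2 - x ^ 2) *
      Real.exp (2 * (x * Real.cosh x / Real.sinh x - 1)) / Real.sinh x ^ 4 := by
    intro x hx
    have hs : 0 < Real.sinh x := Real.sinh_pos_iff.2 hx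
    have hq : 0 < Real.sinh x ^ 2 - x ^ 2 := sub_pos.2 (sq_lt_sinh_sq hx)
    have h4 : 4 * Real.log (Real.sinh x) = Real.log (Real.sinh x ^ 4) := by
      rw [Real.log_pow]; norm_num
    simp only [hD]
    rw [h4, Real.exp_sub, Real.exp_add, Real.exp_log hq, Real.exp_log (by positivity)]
  have hlow : ∀ x, 0 < x → (x / Real.sinh x) ^ 4 ≤ 3 * Real.exp (D x) := by
    intro x hx
    have hs : 0 < Real.sinh x := Real.sinh_pos_iff.2 hx
    have h1 := add_cube_div_six_le_sinh hx.le
    have h2 : x ^ 4 ≤ 3 * (Real.sinh x ^ 2 - x ^ 2) := by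
      have : (x + x ^ 3 / 6) ^ 2 ≤ Real.sinh x ^ 2 := pow_le_pow_left₀ (by positivity) h1 2
      nlinarith [sq_nonneg (x ^ 3)]
    have h3 : 1 ≤ Real.exp (2 * (x * Real.cosh x / Real.sinh x - 1)) := by
      rw [Real.one_le_exp_iff]
      have : 1 ≤ x * Real.cosh x / Real.sinh x := by
        rw [le_div_iff₀ hs, one_mul]; exact sinh_le_mul_cosh hx.le
      linarith
    rw [hexp x hx, div_pow, ← mul_div_assoc, ← mul_assoc]
    gcongr
    nlinarith [pow_pos hx 4]
  have hlim : Filter.Tendsto (fun x : ℝ => (x / Real.sinh x) ^ 4) (nhdsWithin 0 (Set.Ioi 0))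
      (nhds 1) := by
    have h1 : Filter.Tendsto (fun x : ℝ => Real.sinh x / x) (nhdsWithin 0 (Set.Ioi 0))
        (nhds 1) := by
      have := (Real.hasDerivAt_sinh 0).tendsto_slope_zero_right
      simpa [div_eq_inv_mul] using this
    have h2 := (h1.inv₀ one_ne_zero).pow 4
    simpa using h2
  have hfin : 1 ≤ 3 * Real.exp (D u) := by
    refine le_of_tendsto hlim ?_
    filter_upwards [Ioo_mem_nhdsGT hu] with x hx
    refine (hlow x hx.1).trans ?_
    have := hmono (Set.mem_Ioi.2 hx.1) (Set.mem_Ioi.2 hu) hx.2.le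
    gcongr
  have hs : 0 < Real.sinh u := Real.sinh_pos_iff.2 hu
  rw [hexp u hu, ← mul_div_assoc, le_div_iff₀ (by positivity)] at hfin
  linarith

theorem exists_truncation_parameter {κ : ℝ} (h0 : 0 < κ) (h1 : κ < Real.exp 1) :
    ∃ u, 0 < u ∧
      2 * Real.sinh u * Real.exp (1 - u * Real.cosh u / Real.sinh u) = κ := by
  set K : ℝ → ℝ := fun u => 2 * Real.sinh u * Real.exp (1 - u * Real.cosh u / Real.sinh u)
    with hK
  have hcont : ContinuousOn K (Set.Ioi 0) := by
    refine ContinuousOn.mul (by fun_prop) (Real.continuous_exp.comp_continuousOn ?_)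
    refine continuousOn_const.sub (ContinuousOn.div (by fun_prop) (by fun_prop) ?_)
    intro x hx
    exact (Real.sinh_pos_iff.2 hx).ne'
  have hlo : ∃ x ∈ Set.Ioi (0 : ℝ), K x ≤ κ := by
    have ht : Filter.Tendsto (fun x => 2 * Real.sinh x) (nhdsWithin 0 (Set.Ioi 0)) (nhds 0) := by
      have : Continuous (fun x => 2 * Real.sinh x) := by fun_prop
      have := this.tendsto 0
      rw [Real.sinh_zero, mul_zero] at this
      exact this.mono_left nhdsWithin_le_nhds
    obtain ⟨x, hx, hx0⟩ := ((ht.eventually (gt_mem_nhds h0)).and self_mem_nhdsWithin).exists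
    refine ⟨x, hx0, ?_⟩
    have hs : 0 < Real.sinh x := Real.sinh_pos_iff.2 hx0
    have : Real.exp (1 - x * Real.cosh x / Real.sinh x) ≤ 1 := by
      rw [Real.exp_le_one_iff, sub_nonpos, le_div_iff₀ hs, one_mul]
      exact sinh_le_mul_cosh (le_of_lt hx0)
    calc K x ≤ 2 * Real.sinh x * 1 := by simp only [hK]; gcongr
      _ ≤ κ := by linarith
  have hhi : ∃ x ∈ Set.Ioi (0 : ℝ), κ ≤ K x := by
    have hE : Filter.Tendsto (fun x : ℝ => Real.exp (-(2 * x))) Filter.atTop (nhds 0) :=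
      Real.tendsto_exp_neg_atTop_nhds_zero.comp
        (Filter.tendsto_id.const_mul_atTop (by norm_num : (0 : ℝ) < 2))
    have hXE : Filter.Tendsto (fun x : ℝ => 2 * x * Real.exp (-(2 * x))) Filter.atTop
        (nhds 0) := by
      have := (Real.tendsto_pow_mul_exp_neg_atTop_nhds_zero 1).comp
        (Filter.tendsto_id.const_mul_atTop (by norm_num : (0 : ℝ) < 2))
      simpa [Function.comp_def] using this
    have h1E : Filter.Tendsto (fun x : ℝ => 1 - Real.exp (-(2 * x))) Filter.atTop (nhds 1) := by
      simpa using hE.const_sub 1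
    have hlim : Filter.Tendsto (fun x : ℝ => (1 - Real.exp (-(2 * x))) *
        Real.exp (1 - 2 * x * Real.exp (-(2 * x)) / (1 - Real.exp (-(2 * x))))) Filter.atTop
        (nhds (Real.exp 1)) := by
      have h2 := (hXE.div h1E one_ne_zero).const_sub 1
      have h3 := h1E.mul ((Real.continuous_exp.tendsto _).comp h2)
      simpa [Function.comp_def] using h3
    obtain ⟨x, hx, hx0⟩ := ((hlim.eventually (lt_mem_nhds h1)).and
      (Filter.eventually_gt_atTop 0)).exists
    refine ⟨x, hx0, hx.le.trans (le_of_eq ?_)⟩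
    have hs : 0 < Real.sinh x := Real.sinh_pos_iff.2 hx0
    have hA : Real.exp (-(2 * x)) = Real.exp (-x) * Real.exp (-x) := by
      rw [← Real.exp_add]; ring_nf
    have hB : Real.exp x * Real.exp (-x) = 1 := by rw [← Real.exp_add]; simp
    have hC : 1 - Real.exp (-(2 * x)) = 2 * Real.sinh x * Real.exp (-x) := by
      rw [Real.sinh_eq, hA]; linear_combination -hB
    have hD : x * Real.cosh x / Real.sinh x =
        x + 2 * x * Real.exp (-(2 * x)) / (1 - Real.exp (-(2 * x))) := by
      have he := Real.exp_pos (-x)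
      rw [hC, hA]
      field_simp
      rw [Real.cosh_eq, Real.sinh_eq]; ring
    simp only [hK]
    rw [hD, hC, mul_assoc, ← Real.exp_add]
    ring_nf
  obtain ⟨x, hx, hxK⟩ := hlo
  obtain ⟨y, hy, hyK⟩ := hhi
  obtain ⟨u, hu, huK⟩ := isPreconnected_Ioi.intermediate_value hx hy hcont ⟨hxK, hyK⟩
  exact ⟨u, hu, huK⟩

theorem integral_quadratic_mul_exp {k : ℝ} (hk : k ≠ 0) (p q : ℝ) :
    ∫ x in (-p)..q, (x + p) * (q - x) * Real.exp (k * x) =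
      Real.exp (k * q) * ((p + q) / k ^ 2 - 2 / k ^ 3) +
        Real.exp (-(k * p)) * ((p + q) / k ^ 2 + 2 / k ^ 3) := by
  have hd : ∀ x, HasDerivAt (fun x => Real.exp (k * x) *
      ((x + p) * (q - x) / k - (q - p - 2 * x) / k ^ 2 - 2 / k ^ 3))
      ((x + p) * (q - x) * Real.exp (k * x)) x := by
    intro x
    have e1 := ((hasDerivAt_id' x).const_mul k).exp
    have e2 := ((((hasDerivAt_id' x).add_const p).mul ((hasDerivAt_id' x).const_sub q)).div_const
      k).sub ((((hasDerivAt_id' x).const_mul 2).const_sub (q - p)).div_const (k ^ 2))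
    refine (e1.mul (e2.sub_const (2 / k ^ 3))).congr_deriv ?_
    simp only [Pi.sub_apply, Pi.mul_apply]
    field_simp
    ring
  rw [intervalIntegral.integral_eq_sub_of_hasDerivAt (fun x _ => hd x)
    (Continuous.intervalIntegrable (by fun_prop) _ _), mul_neg]
  field_simp
  ring

theorem integral_linear_mul_exp {k : ℝ} (hk : k ≠ 0) (p q : ℝ) :
    ∫ x in (-p)..q, (q - x) * Real.exp (k * x) =
      Real.exp (k * q) / k ^ 2 - Real.exp (-(k * p)) * ((q + p) / k + 1 / k ^ 2) := by
  have hd : ∀ x, HasDerivAt (fun x => Real.exp (k * x) * ((q - x) / k + 1 / k ^ 2))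
      ((q - x) * Real.exp (k * x)) x := by
    intro x
    have e1 := ((hasDerivAt_id' x).const_mul k).exp
    have e2 := (((hasDerivAt_id' x).const_sub q).div_const k).add_const (1 / k ^ 2)
    refine (e1.mul e2).congr_deriv ?_
    field_simp
    ring
  rw [intervalIntegral.integral_eq_sub_of_hasDerivAt (fun x _ => hd x)
    (Continuous.intervalIntegrable (by fun_prop) _ _), mul_neg]
  field_simp
  ring

/-- Weak duality: integrating `g` against `W ≤ B` is bounded by the integral of `g * B` over an
interval outside which `g * W` is nonpositive. -/
theorem integral_mul_le_intervalIntegral_mul {g W B : ℝ → ℝ} {l r : ℝ} (hlr : l ≤ r)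
    (hint : Integrable (fun x => g x * W x)) (hg : Continuous g) (hB : Continuous B)
    (hin : ∀ x ∈ Set.Ioc l r, 0 ≤ g x) (hout : ∀ x ∉ Set.Ioc l r, g x * W x ≤ 0)
    (hWB : ∀ x, W x ≤ B x) :
    ∫ x, g x * W x ≤ ∫ x in l..r, g x * B x := by
  rw [intervalIntegral.integral_of_le hlr, ← integral_indicator measurableSet_Ioc]
  refine integral_mono hint ?_ ?_
  · rw [integrable_indicator_iff measurableSet_Ioc]
    exact ((hg.mul hB).integrableOn_Icc).mono_set Set.Ioc_subset_Icc_self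
  · intro x
    by_cases hx : x ∈ Set.Ioc l r
    · simp only [Set.indicator_of_mem hx]
      exact mul_le_mul_of_nonneg_left (hWB x) (hin x hx)
    · simp only [Set.indicator_of_notMem hx]
      exact hout x hx

theorem mul_sub_integral_sq_le {W B : ℝ → ℝ} {p q : ℝ} (hpq : 0 ≤ p + q)
    (h0 : ∀ x, 0 ≤ W x) (hB : Continuous B) (hWB : ∀ x, W x ≤ B x)
    (i0 : Integrable W) (i1 : Integrable fun x => x * W x) (i2 : Integrable fun x => x ^ 2 * W x)
    (hmass : ∫ x, W x = 1) (hmean : ∫ x, x * W x = 0) :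
    p * q - ∫ x, x ^ 2 * W x ≤ ∫ x in (-p)..q, (x + p) * (q - x) * B x := by
  have he : (fun x => (x + p) * (q - x) * W x) =
      fun x => p * q * W x + (q - p) * (x * W x) - x ^ 2 * W x := by
    ext x; ring
  have i01 : Integrable (fun x => p * q * W x + (q - p) * (x * W x)) :=
    (i0.const_mul _).add (i1.const_mul _)
  have hi : Integrable (fun x => (x + p) * (q - x) * W x) := by
    rw [he]; exact i01.sub i2
  have hv : ∫ x, (x + p) * (q - x) * W x = p * q - ∫ x, x ^ 2 * W x := by
    rw [he, integral_sub i01 i2,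
      integral_add (i0.const_mul _) (i1.const_mul _), integral_const_mul, integral_const_mul,
      hmass, hmean]
    ring
  rw [← hv]
  refine integral_mul_le_intervalIntegral_mul (by linarith) hi (by fun_prop) hB ?_ ?_ hWB
  · intro x hx
    exact mul_nonneg (by linarith [hx.1]) (by linarith [hx.2])
  · intro x hx
    refine mul_nonpos_of_nonpos_of_nonneg ?_ (h0 x)
    by_cases hx1 : -p < x
    · have : q < x := by
        by_contra hq
        exact hx ⟨hx1, not_lt.1 hq⟩
      exact mul_nonpos_of_nonneg_of_nonpos (by linarith) (by linarith)
    · exact mul_nonpos_of_nonpos_of_nonneg (by linarith) (by linarith)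

theorem one_le_twelve_mul_integral_sq_of_pos {W : ℝ → ℝ} {M k A : ℝ} (hM : 0 < M) (hk : 0 < k)
    (h0 : ∀ x, 0 ≤ W x) (hWB : ∀ x, W x ≤ M * Real.exp (k * x))
    (hsupp : ∀ x, x ≤ -A → W x = 0)
    (i0 : Integrable W) (i1 : Integrable fun x => x * W x) (i2 : Integrable fun x => x ^ 2 * W x)
    (hmass : ∫ x, W x = 1) (hmean : ∫ x, x * W x = 0) :
    1 ≤ 12 * M ^ 2 * ∫ x, x ^ 2 * W x := by
  have hkM : k / M < Real.exp 1 := by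
    set r := max A 0 with hr
    have hr0 : 0 ≤ r := le_max_right _ _
    have hrA : A ≤ r := le_max_left _ _
    have hk1 : 0 < 1 / k := by positivity
    have he : (fun x => (1 / k - x) * W x) = fun x => 1 / k * W x - x * W x := by
      ext x; ring
    have hi : Integrable (fun x => (1 / k - x) * W x) := by
      rw [he]; exact (i0.const_mul _).sub i1
    have hv : ∫ x, (1 / k - x) * W x = 1 / k := by
      rw [he, integral_sub (i0.const_mul _) i1, integral_const_mul, hmass, hmean]
      ring
    have hle := integral_mul_le_intervalIntegral_mul (l := -r) (r := 1 / k) (by linarith) hi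
      (by fun_prop) (B := fun x => M * Real.exp (k * x)) (by fun_prop)
      (fun x hx => by linarith [hx.2]) (fun x hx => by
        by_cases hx1 : -r < x
        · have : 1 / k < x := by
            by_contra hq
            exact hx ⟨hx1, not_lt.1 hq⟩
          exact mul_nonpos_of_nonpos_of_nonneg (by linarith) (h0 x)
        · rw [hsupp x (by linarith), mul_zero]) hWB
    have hcomm : ∀ x, (1 / k - x) * (M * Real.exp (k * x)) =
        M * ((1 / k - x) * Real.exp (k * x)) := fun x => by ring
    simp only [hcomm] at hle
    rw [hv, intervalIntegral.integral_const_mul, integral_linear_mul_exp hk.ne',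
      mul_one_div_cancel hk.ne'] at hle
    have hpos : 0 < Real.exp (-(k * r)) * ((1 / k + r) / k + 1 / k ^ 2) := by positivity
    have hlt : 1 / k < M * (Real.exp 1 / k ^ 2) := by
      refine hle.trans_lt (mul_lt_mul_of_pos_left ?_ hM)
      linarith
    rw [div_lt_iff₀ hM]
    rw [← mul_div_assoc, div_lt_div_iff₀ hk (by positivity)] at hlt
    nlinarith
  obtain ⟨u, hu, huK⟩ := exists_truncation_parameter (div_pos hk hM) hkM
  have hs : 0 < Real.sinh u := Real.sinh_pos_iff.2 hu
  set η := u * Real.cosh u / Real.sinh u - 1 with hη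
  have hkey := sinh_pow_four_le hu
  have hneg : 1 - u * Real.cosh u / Real.sinh u = -η := by rw [hη]; ring
  rw [hneg] at huK
  have hkM' : k = M * (2 * Real.sinh u * Real.exp (-η)) := by
    rw [huK]; field_simp
  have hdual := mul_sub_integral_sq_le (p := (u + η) / k) (q := (u - η) / k)
    (by rw [← add_div, add_add_sub_cancel]; positivity) h0
    (B := fun x => M * Real.exp (k * x)) (by fun_prop) hWB i0 i1 i2 hmass hmean
  have hcomm : ∀ x, (x + (u + η) / k) * ((u - η) / k - x) * (M * Real.exp (k * x)) =
      M * ((x + (u + η) / k) * ((u - η) / k - x) * Real.exp (k * x)) := fun x => by ring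
  simp only [hcomm] at hdual
  rw [intervalIntegral.integral_const_mul, integral_quadratic_mul_exp hk.ne',
    mul_div_cancel₀ _ hk.ne', mul_div_cancel₀ _ hk.ne'] at hdual
  have hexp1 : Real.exp (u - η) = Real.exp u * Real.exp (-η) := by rw [← Real.exp_add]; ring_nf
  have hexp2 : Real.exp (-(u + η)) = Real.exp (-u) * Real.exp (-η) := by
    rw [← Real.exp_add]; ring_nf
  have heη := Real.exp_pos (-η)
  have hval : M * (Real.exp (u - η) * (((u + η) / k + (u - η) / k) / k ^ 2 - 2 / k ^ 3) +
      Real.exp (-(u + η)) * (((u + η) / k + (u - η) / k) / k ^ 2 + 2 / k ^ 3)) =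
      2 * η / k ^ 2 := by
    have h1 : M * (Real.exp (u - η) * (((u + η) / k + (u - η) / k) / k ^ 2 - 2 / k ^ 3) +
      Real.exp (-(u + η)) * (((u + η) / k + (u - η) / k) / k ^ 2 + 2 / k ^ 3)) =
      M * Real.exp (-η) * (4 * (u * Real.cosh u - Real.sinh u)) / k ^ 3 := by
      rw [hexp1, hexp2, Real.cosh_eq, Real.sinh_eq]
      field_simp
      ring
    have h2 : u * Real.cosh u - Real.sinh u = Real.sinh u * η := by
      rw [hη]; field_simp
    rw [h1, h2, div_eq_div_iff (by positivity) (by positivity)]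
    linear_combination (-2 * η * k ^ 2) * hkM'
  rw [hval] at hdual
  have hq : (u + η) / k * ((u - η) / k) - 2 * η / k ^ 2 =
      (Real.sinh u ^ 2 - u ^ 2) / (Real.sinh u ^ 2 * k ^ 2) := by
    have hc := Real.cosh_sq u
    rw [hη]
    field_simp
    linear_combination (-u ^ 2) * hc
  have hσ : (Real.sinh u ^ 2 - u ^ 2) / (Real.sinh u ^ 2 * k ^ 2) ≤ ∫ x, x ^ 2 * W x := by
    linarith
  refine le_trans ?_ (mul_le_mul_of_nonneg_left hσ (by positivity))
  have he2 : Real.exp (2 * η) * Real.exp (-η) ^ 2 = 1 := by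
    rw [← Real.exp_nat_mul, ← Real.exp_add]; norm_num
  have hmul := mul_le_mul_of_nonneg_right hkey (sq_nonneg (Real.exp (-η)))
  rw [mul_assoc _ (Real.exp (2 * η)), he2] at hmul
  rw [← mul_div_assoc, le_div_iff₀ (by positivity), hkM']
  nlinarith [mul_le_mul_of_nonneg_left hmul (by positivity : (0 : ℝ) ≤ 4 * M ^ 2)]

/-- A probability density with mean zero and compact support lying below `M * exp (k * x)` has
variance at least `1 / (12 * M ^ 2)`. -/
theorem one_le_twelve_mul_integral_sq {W : ℝ → ℝ} {M k A : ℝ} (hM : 0 < M)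
    (h0 : ∀ x, 0 ≤ W x) (hWB : ∀ x, W x ≤ M * Real.exp (k * x))
    (hsupp : ∀ x, A ≤ |x| → W x = 0)
    (i0 : Integrable W) (i1 : Integrable fun x => x * W x) (i2 : Integrable fun x => x ^ 2 * W x)
    (hmass : ∫ x, W x = 1) (hmean : ∫ x, x * W x = 0) :
    1 ≤ 12 * M ^ 2 * ∫ x, x ^ 2 * W x := by
  rcases lt_trichotomy k 0 with hk | rfl | hk
  · have e1 : (fun x => x * W (-x)) = fun x => -(fun y => y * W y) (-x) := by ext x; simp
    have e2 : (fun x => x ^ 2 * W (-x)) = fun x => (fun y => y ^ 2 * W y) (-x) := by ext x; simp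
    have h := one_le_twelve_mul_integral_sq_of_pos (W := fun x => W (-x)) (A := A) hM
      (neg_pos.2 hk) (fun x => h0 (-x)) (fun x => by simpa using hWB (-x))
      (fun x hx => hsupp (-x) ((le_neg_of_le_neg hx).trans (le_abs_self _))) i0.comp_neg
      (by rw [e1]; exact i1.comp_neg.neg) (by rw [e2]; exact i2.comp_neg)
      (by rw [integral_neg_eq_self W, hmass])
      (by rw [e1, integral_neg, integral_neg_eq_self (fun y => y * W y), hmean, neg_zero])
    rwa [e2, integral_neg_eq_self (fun y => y ^ 2 * W y)] at h
  · have hdual := mul_sub_integral_sq_le (p := 1 / (2 * M)) (q := 1 / (2 * M)) (by positivity) h0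
      (B := fun _ => M) continuous_const (fun x => by simpa using hWB x) i0 i1 i2 hmass hmean
    have hI : ∫ x in (-(1 / (2 * M)))..(1 / (2 * M)),
        (x + 1 / (2 * M)) * (1 / (2 * M) - x) * M = 1 / (6 * M ^ 2) := by
      have hd : ∀ x, HasDerivAt (fun x => M * (x / (2 * M) ^ 2 - x ^ 3 / 3))
          ((x + 1 / (2 * M)) * (1 / (2 * M) - x) * M) x := by
        intro x
        refine ((((hasDerivAt_id' x).div_const _).sub
          ((hasDerivAt_pow 3 x).div_const 3)).const_mul M).congr_deriv ?_
        norm_num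
        field_simp
        ring
      rw [intervalIntegral.integral_eq_sub_of_hasDerivAt (fun x _ => hd x)
        (Continuous.intervalIntegrable (by fun_prop) _ _)]
      field_simp
      norm_num
    rw [hI] at hdual
    have : 1 / (12 * M ^ 2) ≤ ∫ x, x ^ 2 * W x := by
      refine le_trans (le_of_eq ?_) (sub_le_comm.1 hdual)
      field_simp
      norm_num
    rwa [div_le_iff₀ (by positivity), mul_comm] at this
  · exact one_le_twelve_mul_integral_sq_of_pos (A := A) hM hk h0 hWB
      (fun x hx => hsupp x ((le_neg_of_le_neg hx).trans (neg_le_abs x))) i0 i1 i2 hmass hmean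

theorem exists_affine_ge_of_concaveOn {S : Set ℝ} {h : ℝ → ℝ} (hc : ConcaveOn ℝ S h) {x : ℝ}
    (hx : x ∈ interior S) : ∃ s, ∀ y ∈ S, h y ≤ h x + s * (y - x) := by
  have hv := hc.neg
  refine ⟨-derivWithin (-h) (Set.Ioi x) x, fun y hy => ?_⟩
  rcases lt_trichotomy y x with hyx | rfl | hyx
  · have h1 := (hv.slope_le_leftDeriv_of_mem_interior hy hx hyx).trans
      (hv.leftDeriv_le_rightDeriv_of_mem_interior hx)
    rw [slope_def_field, div_le_iff₀ (by linarith)] at h1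
    simp only [Pi.neg_apply] at h1
    linarith
  · simp
  · have h1 := hv.rightDeriv_le_slope_of_mem_interior hx hy hyx
    rw [slope_def_field, le_div_iff₀ (by linarith)] at h1
    simp only [Pi.neg_apply] at h1
    linarith

theorem exists_le_mul_exp_of_rpow_concaveOn {S : Set ℝ} {w : ℝ → ℝ} {n : ℝ} (hn : 0 < n)
    (hw : ∀ x ∈ S, 0 ≤ w x) (hc : ConcaveOn ℝ S fun x => w x ^ (1 / n)) (hS : 0 ∈ interior S)
    (hw0 : 0 < w 0) : ∃ k, ∀ x ∈ S, w x ≤ w 0 * Real.exp (k * x) := by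
  obtain ⟨s, hs⟩ := exists_affine_ge_of_concaveOn hc hS
  set h0 := w 0 ^ (1 / n) with hh0
  have h0pos : 0 < h0 := Real.rpow_pos_of_pos hw0 _
  refine ⟨s / h0 * n, fun x hx => ?_⟩
  have h1 : w x ^ (1 / n) ≤ h0 * Real.exp (s / h0 * x) := by
    have h2 := mul_le_mul_of_nonneg_left (Real.add_one_le_exp (s / h0 * x)) h0pos.le
    have h3 : h0 * (s / h0 * x + 1) = h0 + s * (x - 0) := by field_simp; ring
    rw [h3] at h2
    exact (hs x hx).trans h2
  have h2 := Real.rpow_le_rpow (Real.rpow_nonneg (hw x hx) _) h1 hn.le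
  rw [Real.mul_rpow h0pos.le (Real.exp_pos _).le, hh0, ← Real.rpow_mul (hw x hx),
    ← Real.rpow_mul hw0.le, one_div_mul_cancel hn.ne', Real.rpow_one, Real.rpow_one,
    ← Real.exp_mul] at h2
  convert h2 using 3
  ring

theorem integral_affine_rpow {n γ : ℝ} (hn : 0 < n) (hγ : γ ≠ 0) (x y : ℝ) :
    ∫ t in x..y, (1 + γ * t) ^ n =
      ((1 + γ * y) ^ (n + 1) - (1 + γ * x) ^ (n + 1)) / ((n + 1) * γ) := by
  have hd : ∀ t, HasDerivAt (fun t => (1 + γ * t) ^ (n + 1) / ((n + 1) * γ))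
      ((1 + γ * t) ^ n) t := by
    intro t
    refine (((((hasDerivAt_id' t).const_mul γ).const_add 1).rpow_const
      (Or.inr (by linarith : 1 ≤ n + 1))).div_const ((n + 1) * γ)).congr_deriv ?_
    rw [add_sub_cancel_right]
    field_simp
  rw [intervalIntegral.integral_eq_sub_of_hasDerivAt (fun t _ => hd t)
    (Continuous.intervalIntegrable ((by fun_prop : Continuous fun t => 1 + γ * t).rpow_const
      fun _ => Or.inr hn.le) _ _)]
  ring

theorem le_mul_rpow_of_rpow_le {n m v l : ℝ} (hn : 0 < n) (hv : 0 ≤ v) (hm : 0 ≤ m) (hl : 0 ≤ l)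
    (h : v ^ (1 / n) ≤ m ^ (1 / n) * l) : v ≤ m * l ^ n := by
  have h2 := Real.rpow_le_rpow (Real.rpow_nonneg hv _) h hn.le
  rwa [Real.mul_rpow (Real.rpow_nonneg hm _) hl, ← Real.rpow_mul hv, ← Real.rpow_mul hm,
    one_div_mul_cancel hn.ne', Real.rpow_one, Real.rpow_one] at h2

theorem mul_rpow_le_of_le_rpow {n m v l : ℝ} (hn : 0 < n) (hv : 0 ≤ v) (hm : 0 ≤ m) (hl : 0 ≤ l)
    (h : m ^ (1 / n) * l ≤ v ^ (1 / n)) : m * l ^ n ≤ v := by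
  have h2 := Real.rpow_le_rpow (mul_nonneg (Real.rpow_nonneg hm _) hl) h hn.le
  rwa [Real.mul_rpow (Real.rpow_nonneg hm _) hl, ← Real.rpow_mul hv, ← Real.rpow_mul hm,
    one_div_mul_cancel hn.ne', Real.rpow_one, Real.rpow_one] at h2

theorem affine_rpow_intervalIntegrable {n γ m : ℝ} (hn : 0 < n) (x y : ℝ) :
    IntervalIntegrable (fun t => m * (1 + γ * t) ^ n) volume x y :=
  Continuous.intervalIntegrable (continuous_const.mul
    ((by fun_prop : Continuous fun t => 1 + γ * t).rpow_const fun _ => Or.inr hn.le)) _ _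

theorem integral_le_of_rpow_le_affine {n γ m a x : ℝ} {w : ℝ → ℝ} (hn : 0 < n) (hγ : 0 < γ)
    (hm : 0 < m) (hax : a < x) (hw : ∀ t ∈ Set.Ioo a x, 0 ≤ w t)
    (hint : IntervalIntegrable w volume a x)
    (hle : ∀ t ∈ Set.Ioo a x, w t ^ (1 / n) ≤ m ^ (1 / n) * (1 + γ * t)) :
    ∫ t in a..x, w t ≤ m / ((n + 1) * γ) * (1 + γ * x) ^ (n + 1) := by
  have hl : ∀ t ∈ Set.Ioo a x, 0 ≤ 1 + γ * t := fun t ht =>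
    nonneg_of_mul_nonneg_right ((Real.rpow_nonneg (hw t ht) _).trans (hle t ht))
      (Real.rpow_pos_of_pos hm _)
  have hla : 0 ≤ 1 + γ * a := by
    by_contra hneg
    push Not at hneg
    obtain ⟨t, ht1, ht2⟩ := exists_between (lt_min hax
      (by rw [lt_div_iff₀ hγ]; linarith : a < -1 / γ))
    have h1 := hl t ⟨ht1, ht2.trans_le (min_le_left _ _)⟩
    have h2 := ht2.trans_le (min_le_right _ _)
    rw [lt_div_iff₀ hγ] at h2
    linarith
  have h1 := intervalIntegral.integral_mono_on_of_le_Ioo hax.le hint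
    (affine_rpow_intervalIntegrable (m := m) (γ := γ) hn a x) (fun t ht =>
      le_mul_rpow_of_rpow_le hn (hw t ht) hm.le (hl t ht) (hle t ht))
  rw [intervalIntegral.integral_const_mul, integral_affine_rpow hn hγ.ne'] at h1
  refine h1.trans ?_
  have h2 : 0 ≤ m / ((n + 1) * γ) * (1 + γ * a) ^ (n + 1) :=
    mul_nonneg (by positivity) (Real.rpow_nonneg hla _)
  have h3 : m * (((1 + γ * x) ^ (n + 1) - (1 + γ * a) ^ (n + 1)) / ((n + 1) * γ)) =
      m / ((n + 1) * γ) * (1 + γ * x) ^ (n + 1) - m / ((n + 1) * γ) * (1 + γ * a) ^ (n + 1) := by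
    ring
  linarith

/-- One-dimensional Brunn-Minkowski inequality in tangent form: if `w ^ (1 / n)` is concave then
the `1 / (n + 1)`-th power of the cumulative distribution function of `w` lies below its tangent
line at `0`. -/
theorem integral_le_tangent_rpow {n β R₀ a b x : ℝ} {w : ℝ → ℝ} (hn : 0 < n)
    (ha : a < 0) (hb : 0 < b) (hw : ∀ t ∈ Set.Ioo a b, 0 ≤ w t) (hw0 : 0 < w 0)
    (hint : IntervalIntegrable w volume a b)
    (hc : ConcaveOn ℝ (Set.Ioo a b) fun x => w x ^ (1 / n))
    (hR : R₀ = ∫ t in a..0, w t) (hβ : 0 < β) (hβR : R₀ * ((n + 1) * β) = w 0)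
    (hax : a < x) (hxb : x ≤ b) :
    ∫ t in a..x, w t ≤ R₀ * (max (1 + β * x) 0) ^ (n + 1) := by
  have hR' : w 0 / ((n + 1) * β) = R₀ := by
    rw [div_eq_iff (by positivity), hβR]
  have hR0 : 0 < R₀ := by rw [← hR']; positivity
  have hsub : ∀ {l r}, a ≤ l → l ≤ r → r ≤ b → IntervalIntegrable w volume l r :=
    fun h1 h2 h3 => hint.mono_set (by
      rw [Set.uIcc_of_le h2, Set.uIcc_of_le (ha.trans hb).le]; exact Set.Icc_subset_Icc h1 h3)
  have hm0 : (0 : ℝ) ∈ Set.Ioo a b := ⟨ha, hb⟩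
  have hhpos : 0 < w 0 ^ (1 / n) := Real.rpow_pos_of_pos hw0 _
  rcases le_or_gt 0 x with hx | hx
  · have hle : ∀ y ∈ Set.Ioo 0 b, w y ^ (1 / n) ≤ w 0 ^ (1 / n) * (1 + β * y) := by
      intro y hy
      by_contra hcon
      push Not at hcon
      set β' := (w y ^ (1 / n) / w 0 ^ (1 / n) - 1) / y with hβ'
      have hββ : β < β' := by
        rw [hβ', lt_div_iff₀ hy.1, lt_sub_iff_add_lt, lt_div_iff₀ hhpos]
        linarith
      have hyv : w y ^ (1 / n) = w 0 ^ (1 / n) * (1 + β' * y) := by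
        rw [hβ', div_mul_cancel₀ _ hy.1.ne', add_sub_cancel, mul_div_cancel₀ _ hhpos.ne']
      have h1 := integral_le_of_rpow_le_affine hn (hβ.trans hββ) hw0 ha
        (fun t ht => hw t ⟨ht.1, ht.2.trans hb⟩) (hsub le_rfl ha.le hb.le) (by
          intro t ht
          have h2 := hc.slope_anti_adjacent ⟨ht.1, ht.2.trans hb⟩ ⟨ha.trans hy.1, hy.2⟩ ht.2 hy.1
          have h3 : (w y ^ (1 / n) - w 0 ^ (1 / n)) / (y - 0) = w 0 ^ (1 / n) * β' := by
            rw [hyv, sub_zero, div_eq_iff hy.1.ne']; ring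
          rw [h3, le_div_iff₀ (by linarith [ht.2])] at h2
          linarith)
      rw [← hR, mul_zero, add_zero, Real.one_rpow, mul_one, ← hR'] at h1
      have h2 : w 0 / ((n + 1) * β') < w 0 / ((n + 1) * β) := by
        gcongr
      linarith
    have h1 := intervalIntegral.integral_mono_on_of_le_Ioo hx (hsub ha.le hx hxb)
      (affine_rpow_intervalIntegrable (m := w 0) (γ := β) hn 0 x) (fun t ht =>
        le_mul_rpow_of_rpow_le hn (hw t ⟨ha.trans ht.1, ht.2.trans_le hxb⟩) hw0.le
          (by have := mul_pos hβ ht.1; linarith) (hle t ⟨ht.1, ht.2.trans_le hxb⟩))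
    rw [intervalIntegral.integral_const_mul, integral_affine_rpow hn hβ.ne', mul_zero, add_zero,
      Real.one_rpow] at h1
    have h2 : w 0 * (((1 + β * x) ^ (n + 1) - 1) / ((n + 1) * β)) =
        R₀ * (1 + β * x) ^ (n + 1) - R₀ := by
      rw [← hR']; ring
    rw [max_eq_left (by positivity), ← intervalIntegral.integral_add_adjacent_intervals
      (hsub le_rfl ha.le hb.le) (hsub ha.le hx hxb), ← hR]
    linarith
  · have hmx : x ∈ Set.Ioo a b := ⟨hax, hx.trans hb⟩
    rcases le_or_gt (w x ^ (1 / n)) (w 0 ^ (1 / n) * (1 + β * x)) with hcase | hcase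
    · have hlx : 0 ≤ 1 + β * x :=
        nonneg_of_mul_nonneg_right ((Real.rpow_nonneg (hw x hmx) _).trans hcase) hhpos
      have h1 := integral_le_of_rpow_le_affine hn hβ hw0 hax
        (fun t ht => hw t ⟨ht.1, ht.2.trans hmx.2⟩) (hsub le_rfl hax.le hxb) (by
          intro t ht
          have h2 := hc.slope_anti_adjacent ⟨ht.1, ht.2.trans hmx.2⟩ hm0 ht.2 hx
          have h3 : w 0 ^ (1 / n) * β ≤ (w 0 ^ (1 / n) - w x ^ (1 / n)) / (0 - x) := by
            rw [le_div_iff₀ (by linarith)]; linarith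
          have h4 := h3.trans h2
          rw [le_div_iff₀ (by linarith [ht.2])] at h4
          linarith)
      rwa [hR', ← max_eq_left hlx] at h1
    · have hge : ∀ t ∈ Set.Ioo x 0, w 0 ^ (1 / n) * (1 + β * t) ≤ w t ^ (1 / n) := by
        intro t ht
        by_contra hcon
        push Not at hcon
        have h2 := hc.slope_anti_adjacent hmx hm0 ht.1 ht.2
        have h3 : w 0 ^ (1 / n) * β < (w 0 ^ (1 / n) - w t ^ (1 / n)) / (0 - t) := by
          rw [lt_div_iff₀ (by linarith [ht.2])]; linarith
        have h4 := h3.trans_le h2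
        rw [lt_div_iff₀ (by linarith [ht.1])] at h4
        linarith
      set y := max x (-1 / β) with hy
      have hxy : x ≤ y := le_max_left _ _
      have hy0 : y ≤ 0 := max_le hx.le (by rw [div_le_iff₀ hβ]; linarith)
      have hyl : 1 + β * y = max (1 + β * x) 0 := by
        rw [hy, mul_max_of_nonneg _ _ hβ.le, ← max_add_add_left, mul_div_cancel₀ _ hβ.ne']
        norm_num
      have hly : 0 ≤ 1 + β * y := hyl ▸ le_max_right _ _
      have h1 := intervalIntegral.integral_mono_on_of_le_Ioo hy0
        (affine_rpow_intervalIntegrable (m := w 0) (γ := β) hn y 0)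
        (hsub (hax.le.trans hxy) hy0 hb.le) (fun t ht =>
          mul_rpow_le_of_le_rpow hn (hw t ⟨(hax.trans_le hxy).trans ht.1, ht.2.trans hb⟩) hw0.le
            (by have := mul_lt_mul_of_pos_left ht.1 hβ; linarith)
            (hge t ⟨hxy.trans_lt ht.1, ht.2⟩))
      rw [intervalIntegral.integral_const_mul, integral_affine_rpow hn hβ.ne', mul_zero, add_zero,
        Real.one_rpow, hyl] at h1
      have h2 : w 0 * ((1 - (max (1 + β * x) 0) ^ (n + 1)) / ((n + 1) * β)) =
          R₀ - R₀ * (max (1 + β * x) 0) ^ (n + 1) := by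
        rw [← hR']; ring
      have h3 : 0 ≤ ∫ t in x..y, w t := by
        rw [intervalIntegral.integral_of_le hxy, integral_Ioc_eq_integral_Ioo]
        exact setIntegral_nonneg measurableSet_Ioo fun t ht =>
          hw t ⟨hax.trans ht.1, (ht.2.trans_le hy0).trans hb⟩
      have h4 := intervalIntegral.integral_add_adjacent_intervals
        (hsub le_rfl hax.le hxb) (hsub hax.le hxy (hy0.trans hb.le))
      have h5 := intervalIntegral.integral_add_adjacent_intervals
        (hsub le_rfl (hax.le.trans hxy) (hy0.trans hb.le)) (hsub (hax.le.trans hxy) hy0 hb.le)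
      linarith

theorem integral_pos_of_rpow_concaveOn {n a b : ℝ} {w : ℝ → ℝ} (hn : 0 < n)
    (ha : a < 0) (hb : 0 < b) (hw : ∀ t ∈ Set.Ioo a b, 0 ≤ w t) (hw0 : 0 < w 0)
    (hint : IntervalIntegrable w volume a 0)
    (hc : ConcaveOn ℝ (Set.Ioo a b) fun x => w x ^ (1 / n)) : 0 < ∫ t in a..0, w t := by
  refine intervalIntegral.intervalIntegral_pos_of_pos_on hint (fun t ht => ?_) ha
  have hmt : t ∈ Set.Ioo a b := ⟨ht.1, ht.2.trans hb⟩
  refine lt_of_le_of_ne (hw t hmt) fun h0 => ?_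
  have hs : (a + t) / 2 ∈ Set.Ioo a b := ⟨by linarith [ht.1], by linarith [ht.1, hmt.2]⟩
  have h1 := hc.slope_anti_adjacent hs ⟨ha, hb⟩ (by linarith [ht.1] : (a + t) / 2 < t) ht.2
  rw [← h0, Real.zero_rpow (by positivity), sub_zero, zero_sub, zero_sub] at h1
  have h2 : 0 < w 0 ^ (1 / n) / -t := div_pos (Real.rpow_pos_of_pos hw0 _) (by linarith [ht.2])
  have h3 : -w ((a + t) / 2) ^ (1 / n) / (t - (a + t) / 2) ≤ 0 :=
    div_nonpos_of_nonpos_of_nonneg (neg_nonpos.2 (Real.rpow_nonneg (hw _ hs) _))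
      (by linarith [ht.1])
  linarith

theorem truncatedPower_integral {N β C p l r : ℝ} (hN : 0 < N) (hβ : 0 < β) (hl : l ≤ -1 / β)
    (hp : -1 / β ≤ p) (hr : p ≤ r) {G : ℝ → ℝ}
    (hG : ∀ x, G x = if x ≤ p then C * (max (1 + β * x) 0) ^ N else 1) :
    IntervalIntegrable G volume l r ∧
      ∫ x in l..r, G x = C * ((1 + β * p) ^ (N + 1) / ((N + 1) * β)) + (r - p) := by
  have h1 : Set.EqOn (fun _ => (0 : ℝ)) G (Set.uIoo l (-1 / β)) := by
    intro x hx
    rw [Set.uIoo_of_le hl] at hx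
    have h2 := hx.2
    rw [lt_div_iff₀ hβ] at h2
    rw [hG, if_pos (hx.2.le.trans hp), max_eq_right (by linarith), Real.zero_rpow hN.ne', mul_zero]
  have h2 : Set.EqOn (fun x => C * (1 + β * x) ^ N) G (Set.uIoo (-1 / β) p) := by
    intro x hx
    rw [Set.uIoo_of_le hp] at hx
    have h2 := hx.1
    rw [div_lt_iff₀ hβ] at h2
    simp only
    rw [hG, if_pos hx.2.le, max_eq_left (by linarith)]
  have h3 : Set.EqOn (fun _ => (1 : ℝ)) G (Set.uIoo p r) := by
    intro x hx
    rw [Set.uIoo_of_le hr] at hx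
    rw [hG, if_neg (not_le.2 hx.1)]
  have i1 := (intervalIntegrable_const (μ := volume)).congr_uIoo h1
  have i2 := (affine_rpow_intervalIntegrable (m := C) hN _ _).congr_uIoo h2
  have i3 := (intervalIntegrable_const (μ := volume)).congr_uIoo h3
  refine ⟨(i1.trans i2).trans i3, ?_⟩
  rw [← intervalIntegral.integral_add_adjacent_intervals (i1.trans i2) i3,
    ← intervalIntegral.integral_add_adjacent_intervals i1 i2,
    ← intervalIntegral.integral_congr_uIoo h1, ← intervalIntegral.integral_congr_uIoo h2,
    ← intervalIntegral.integral_congr_uIoo h3, intervalIntegral.integral_const_mul,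
    integral_affine_rpow hN hβ.ne', mul_div_cancel₀ _ hβ.ne']
  have h0 : (1 + -1 : ℝ) ^ (N + 1) = 0 := by
    rw [add_neg_cancel, Real.zero_rpow (by positivity)]
  rw [h0]
  simp

theorem integral_abs_sub_truncatedPower_le {N c a b ε : ℝ} {R F : ℝ → ℝ} (hN : 0 < N) (hc : 0 < c)
    (hε : 0 < ε) (hab : a ≤ b) (hRcont : Continuous R) (hRa : ∀ x ≤ a, R x = 0)
    (hRb : ∀ x, b ≤ x → R x = 1) (hR1 : ∀ x, R x ≤ 1) (hRint : ∫ x in a..b, R x = b)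
    (hRle : ∀ x, R x ≤ (1 + ε) * (N / (N + 1)) ^ N * (max (1 + c / N * x) 0) ^ N)
    (hF : ∀ x, F x =
      if x ≤ 1 / c then (N / (N + 1)) ^ N * (max (1 + c / N * x) 0) ^ N else 1) :
    ∫ x, |R x - F x| ≤ 2 * N * (1 - (1 + ε) ^ (-1 / N)) / c := by
  set δ := (1 + ε) ^ (-1 / N) with hδ
  set α := (N / (N + 1)) ^ N with hα
  have hε1 : 0 < 1 + ε := by linarith
  have hδ0 : 0 < δ := Real.rpow_pos_of_pos hε1 _
  have hδ1 : δ ≤ 1 := Real.rpow_le_one_of_one_le_of_nonpos (by linarith)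
    (div_nonpos_of_nonpos_of_nonneg (by norm_num) hN.le)
  have hα0 : 0 < α := by positivity
  have hαN : α * ((N + 1) / N) ^ N = 1 := by
    rw [hα, ← Real.mul_rpow (by positivity) (by positivity)]
    have : N / (N + 1) * ((N + 1) / N) = 1 := by field_simp
    rw [this, Real.one_rpow]
  have hδN : (1 + ε) * δ ^ N = 1 := by
    rw [hδ, ← Real.rpow_mul hε1.le, div_mul_cancel₀ _ hN.ne', Real.rpow_neg_one,
      mul_inv_cancel₀ hε1.ne']
  have hβ : 0 < c / N := by positivity
  have hNc : -1 / (c / N) = -N / c := by field_simp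
  set p := ((N + 1) * δ - N) / c with hp
  have hpc : p ≤ 1 / c := by rw [hp]; gcongr; nlinarith
  have hpN : -N / c ≤ p := by rw [hp]; gcongr; nlinarith
  set l := min a (-N / c) with hl
  set r := max b (1 / c) with hr
  have hla : l ≤ a := min_le_left _ _
  have hlN : l ≤ -N / c := min_le_right _ _
  have hbr : b ≤ r := le_max_left _ _
  have hcr : 1 / c ≤ r := le_max_right _ _
  set G : ℝ → ℝ := fun x =>
    if x ≤ p then (1 + ε) * α * (max (1 + c / N * x) 0) ^ N else 1 with hG
  obtain ⟨iG, hGint⟩ := truncatedPower_integral (G := G) hN hβ (hNc ▸ hlN) (hNc ▸ hpN)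
    (hpc.trans hcr) (fun _ => rfl)
  obtain ⟨iF, hFint⟩ := truncatedPower_integral hN hβ (hNc ▸ hlN)
    (hNc ▸ (hpN.trans hpc)) hcr hF
  have iR : ∀ x y, IntervalIntegrable R volume x y := fun x y => hRcont.intervalIntegrable x y
  have hRtot : ∫ x in l..r, R x = r := by
    have e1 : ∫ x in l..a, R x = 0 := by
      rw [intervalIntegral.integral_congr (g := fun _ => (0 : ℝ))]
      · simp
      · intro x hx
        rw [Set.uIcc_of_le hla] at hx
        exact hRa x hx.2
    have e2 : ∫ x in b..r, R x = r - b := by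
      rw [intervalIntegral.integral_congr (g := fun _ => (1 : ℝ))]
      · simp
      · intro x hx
        rw [Set.uIcc_of_le hbr] at hx
        exact hRb x hx.1
    rw [← intervalIntegral.integral_add_adjacent_intervals (iR l b) (iR b r),
      ← intervalIntegral.integral_add_adjacent_intervals (iR l a) (iR a b), e1, e2, hRint]
    ring
  have hFtot : ∫ x in l..r, F x = r := by
    have h1 : 1 + c / N * (1 / c) = (N + 1) / N := by field_simp
    rw [hFint, h1, Real.rpow_add (by positivity), Real.rpow_one, mul_div_assoc, ← mul_assoc, hαN]
    field_simp
    ring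
  have hGtot : ∫ x in l..r, G x = r + N * (1 - δ) / c := by
    have h1 : 1 + c / N * p = (N + 1) / N * δ := by rw [hp]; field_simp; ring
    have h2 : (1 + ε) * α * (((N + 1) / N * δ) ^ (N + 1)) = (N + 1) / N * δ := by
      rw [Real.rpow_add (by positivity), Real.rpow_one, Real.mul_rpow (by positivity) hδ0.le]
      linear_combination ((1 + ε) * δ ^ N * ((N + 1) / N * δ)) * hαN + ((N + 1) / N * δ) * hδN
    rw [hGint, h1, ← mul_div_assoc, h2, hp]
    field_simp
    ring
  have hzero : ∀ x, x ∉ Set.Ioc l r → |R x - F x| = 0 := by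
    intro x hx
    rw [abs_eq_zero, sub_eq_zero]
    rcases le_or_gt x l with hxl | hxl
    · have h1 := hxl.trans hlN
      rw [le_div_iff₀ hc] at h1
      have h2 : 1 + c / N * x ≤ 0 := by
        have : 1 + c / N * x = (N + x * c) / N := by field_simp
        rw [this]
        exact div_nonpos_of_nonpos_of_nonneg (by linarith) hN.le
      rw [hRa x (hxl.trans hla), hF, if_pos (hxl.trans (hlN.trans (hpN.trans hpc))),
        max_eq_right h2, Real.zero_rpow hN.ne', mul_zero]
    · have hrx : r < x := by
        by_contra hcon
        exact hx ⟨hxl, not_lt.1 hcon⟩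
      rw [hRb x (hbr.trans hrx.le), hF, if_neg (not_le.2 (hcr.trans_lt hrx))]
  have hRG : ∀ x, R x ≤ G x := by
    intro x
    simp only [hG]
    split_ifs
    · exact hRle x
    · exact hR1 x
  have hFG : ∀ x, F x ≤ G x := by
    intro x
    simp only [hG, hF]
    split_ifs with h1 h2 h2
    · rw [mul_assoc]
      exact le_mul_of_one_le_left (by positivity) (by linarith)
    · have h3 : max (1 + c / N * x) 0 ≤ (N + 1) / N := by
        refine max_le ?_ (by positivity)
        have h4 : 1 + c / N * (1 / c) = (N + 1) / N := by field_simp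
        rw [← h4]
        gcongr
      exact (mul_le_mul_of_nonneg_left (Real.rpow_le_rpow (le_max_right _ _) h3 hN.le)
        hα0.le).trans hαN.le
    · exact absurd (h2.trans hpc) h1
    · exact le_rfl
  have hlr : l ≤ r := hla.trans (hab.trans hbr)
  rw [← setIntegral_eq_integral_of_forall_compl_eq_zero hzero,
    ← intervalIntegral.integral_of_le hlr]
  have hmono : ∫ x in l..r, |R x - F x| ≤ ∫ x in l..r, (2 * G x - R x - F x) := by
    refine intervalIntegral.integral_mono_on hlr ((iR l r).sub iF).abs
      (((iG.const_mul 2).sub (iR l r)).sub iF) fun x _ => ?_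
    rw [abs_le]
    constructor <;> linarith [hRG x, hFG x]
  rw [intervalIntegral.integral_sub ((iG.const_mul 2).sub (iR l r)) iF,
    intervalIntegral.integral_sub (iG.const_mul 2) (iR l r), intervalIntegral.integral_const_mul,
    hGtot, hRtot, hFtot] at hmono
  refine hmono.trans (le_of_eq ?_)
  ring

/-- Integration by parts for the cumulative distribution function of a density vanishing outside
an interval. -/
theorem integral_cdf_eq {a b : ℝ} {W : ℝ → ℝ} (hab : a ≤ b) (hW : Integrable W)
    (hcont : ContinuousOn W (Set.Ioo a b)) (hmass : ∫ x in a..b, W x = 1)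
    (hmean : ∫ x in a..b, x * W x = 0) : ∫ x in a..b, (∫ t in a..x, W t) = b := by
  have h := intervalIntegral.integral_mul_deriv_eq_deriv_mul_of_hasDeriv_right
    (a := a) (b := b) (u := fun x => x) (v := fun x => ∫ t in a..x, W t) (u' := fun _ => 1)
    (v' := W) continuousOn_id (hW.continuous_primitive a).continuousOn
    (fun x _ => (hasDerivAt_id' x).hasDerivWithinAt) (fun x hx => by
      rw [min_eq_left hab, max_eq_right hab] at hx
      have hx' := isOpen_Ioo.mem_nhds hx
      exact (intervalIntegral.integral_hasDerivAt_right hW.intervalIntegrable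
        (hcont.stronglyMeasurableAtFilter isOpen_Ioo x hx)
        (hcont.continuousAt hx')).hasDerivWithinAt)
    intervalIntegrable_const hW.intervalIntegrable
  simp only [hmean, hmass, intervalIntegral.integral_same, one_mul, mul_one, mul_zero,
    sub_zero] at h
  linarith

/-- Stability of the one-dimensional Grünbaum inequality for `N ∈ (1,∞)`: if the
Grünbaum bound is almost attained, then the cumulative distribution function `R`
of `w` is close in `L¹(ℝ)` to the cumulative distribution function `F` of the
rigidity model density. -/
theorem grunbaum_one_dim_pos_stability (N a b ε : ℝ) (w R F : ℝ → ℝ) (c : ℝ)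
    (hN : 1 < N) (ha : a < 0) (hb : 0 < b)
    (hw : ∀ x ∈ Set.Ioo a b, 0 ≤ w x)
    (hcont : ContinuousOn w (Set.Ioo a b)) (hw0 : 0 < w 0)
    (hint : IntegrableOn w (Set.Ioo a b))
    (hconc : ConcaveOn ℝ (Set.Ioo a b) (fun x => w x ^ (1 / (N - 1))))
    (hmass : ∫ x in Set.Ioo a b, w x = 1)
    (hbar : ∫ x in Set.Ioo a b, x * w x = 0)
    (hR : ∀ x : ℝ, R x = ∫ s in Set.Ioo a (min x b), w s)
    (hc : c = w 0 / R 0)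
    (hF : ∀ x : ℝ, F x =
      if x < -N / c then 0
      else if x ≤ 1 / c then (N / (N + 1)) ^ N * (1 + (c / N) * x) ^ N
      else 1)
    (hε : 0 < ε)
    (hclose : R 0 ≤ (1 + ε) * (N / (N + 1)) ^ N) :
    (∫ x : ℝ, |R x - F x|) ≤
      4 * Real.sqrt 3 * N ^ (N + 1) / (N + 1) ^ N * (1 + ε) *
        (1 - (1 + ε) ^ (-1 / N)) *
        (∫ x in Set.Ioo a b, x ^ 2 * w x) ^ ((1 : ℝ) / 2) := by
  have hn : 0 < N - 1 := by linarith
  have hN0 : 0 < N := by linarith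
  have hab : a < b := ha.trans hb
  have h0mem : (0 : ℝ) ∈ Set.Ioo a b := ⟨ha, hb⟩
  set W : ℝ → ℝ := (Set.Ioo a b).indicator w with hWdef
  have hWin : ∀ x ∈ Set.Ioo a b, W x = w x := fun x hx => Set.indicator_of_mem hx w
  have hWout : ∀ x ∉ Set.Ioo a b, W x = 0 := fun x hx => Set.indicator_of_notMem hx w
  have hWnn : ∀ x, 0 ≤ W x := fun x => Set.indicator_nonneg hw x
  have hWint : Integrable W := hint.integrable_indicator measurableSet_Ioo
  have hgW : ∀ g : ℝ → ℝ, (fun x => g x * W x) = (Set.Ioo a b).indicator fun x => g x * w x := by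
    intro g
    ext x
    by_cases hx : x ∈ Set.Ioo a b
    · rw [hWin x hx, Set.indicator_of_mem hx]
    · rw [hWout x hx, Set.indicator_of_notMem hx, mul_zero]
  have hgint : ∀ g : ℝ → ℝ, Continuous g → Integrable fun x => g x * W x := by
    intro g hg
    rw [hgW, integrable_indicator_iff measurableSet_Ioo]
    have h1 := ((integrableOn_Icc_iff_integrableOn_Ioo).2 hint).continuousOn_mul
      hg.continuousOn isCompact_Icc
    exact h1.mono_set Set.Ioo_subset_Icc_self
  have hgval : ∀ g : ℝ → ℝ, ∫ x, g x * W x = ∫ x in Set.Ioo a b, g x * w x := by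
    intro g
    rw [hgW, integral_indicator measurableSet_Ioo]
  have hWmass : ∫ x, W x = 1 := by
    rw [hWdef, integral_indicator measurableSet_Ioo, hmass]
  have hwint : IntervalIntegrable w volume a b := by
    rw [intervalIntegrable_iff_integrableOn_Ioo_of_le hab.le]
    exact hint
  have hRw : ∀ x, a ≤ x → x ≤ b → R x = ∫ t in a..x, w t := by
    intro x hax hxb
    rw [hR, min_eq_left hxb, intervalIntegral.integral_of_le hax, integral_Ioc_eq_integral_Ioo]
  have hwW : ∀ x, a ≤ x → x ≤ b → ∫ t in a..x, W t = ∫ t in a..x, w t := by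
    intro x hax hxb
    refine intervalIntegral.integral_congr_Ioo_of_le hax fun t ht => ?_
    exact hWin t ⟨ht.1, ht.2.trans_le hxb⟩
  have hRa : ∀ x ≤ a, R x = 0 := by
    intro x hx
    rw [hR, Set.Ioo_eq_empty (not_lt.2 ((min_le_left _ _).trans hx)), setIntegral_empty]
  have hRb : ∀ x, b ≤ x → R x = 1 := by
    intro x hx
    rw [hR, min_eq_right hx, hmass]
  have hRW : ∀ x, R x = ∫ t in a..x, W t := by
    intro x
    rcases le_total x a with hxa | hax
    · rw [hRa x hxa, intervalIntegral.integral_congr (g := fun _ => (0 : ℝ))]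
      · simp
      · intro t ht
        rw [Set.uIcc_of_ge hxa] at ht
        exact hWout t fun h => absurd h.1 (not_lt.2 ht.2)
    · rcases le_total x b with hxb | hbx
      · rw [hRw x hax hxb, hwW x hax hxb]
      · have h1 : ∫ t in b..x, W t = 0 := by
          rw [intervalIntegral.integral_congr (g := fun _ => (0 : ℝ))]
          · simp
          · intro t ht
            rw [Set.uIcc_of_le hbx] at ht
            exact hWout t fun h => absurd h.2 (not_lt.2 ht.1)
        rw [← intervalIntegral.integral_add_adjacent_intervals (b := b) hWint.intervalIntegrable
          hWint.intervalIntegrable, h1, hwW b hab.le le_rfl, ← hRw b hab.le le_rfl,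
          hRb x hbx, hRb b le_rfl, add_zero]
  have hRcont : Continuous R := by
    rw [funext hRW]
    exact hWint.continuous_primitive a
  have hRmono : ∀ x y, x ≤ y → R x ≤ R y := by
    intro x y hxy
    have h1 := intervalIntegral.integral_add_adjacent_intervals (a := a) (b := x) (c := y)
      hWint.intervalIntegrable hWint.intervalIntegrable
    have h2 := intervalIntegral.integral_nonneg_of_forall (μ := volume) hxy hWnn
    rw [hRW, hRW]
    linarith
  have hR1 : ∀ x, R x ≤ 1 := fun x =>
    (hRmono x (max x b) (le_max_left _ _)).trans_eq (hRb _ (le_max_right _ _))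
  have hRint : ∫ x in a..b, R x = b := by
    have h1 : ∫ x in a..b, x * W x = 0 := by
      rw [← hbar, intervalIntegral.integral_of_le hab.le, integral_Ioc_eq_integral_Ioo]
      exact setIntegral_congr_fun measurableSet_Ioo fun x hx => by simp only [hWin x hx]
    rw [funext hRW]
    exact integral_cdf_eq hab.le hWint (hcont.congr hWin) (by rw [← hRW, hRb b le_rfl]) h1
  have hR0w : R 0 = ∫ t in a..0, w t := hRw 0 ha.le hb.le
  have hR0 : 0 < R 0 := by
    rw [hR0w]
    exact integral_pos_of_rpow_concaveOn hn ha hb hw hw0 (hwint.mono_set (by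
      rw [Set.uIcc_of_le ha.le, Set.uIcc_of_le hab.le]
      exact Set.Icc_subset_Icc le_rfl hb.le)) hconc
  have hcpos : 0 < c := by rw [hc]; positivity
  have hβR : R 0 * ((N - 1 + 1) * (c / N)) = w 0 := by
    rw [sub_add_cancel, mul_div_cancel₀ _ hN0.ne', hc, mul_div_cancel₀ _ hR0.ne']
  have htan : ∀ x, R x ≤ R 0 * (max (1 + c / N * x) 0) ^ N := by
    have h1 : ∀ x, a < x → x ≤ b → R x ≤ R 0 * (max (1 + c / N * x) 0) ^ N := by
      intro x hax hxb
      have h2 := integral_le_tangent_rpow hn ha hb hw hw0 hwint hconc hR0w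
        (by positivity : 0 < c / N) hβR hax hxb
      rwa [← hRw x hax.le hxb, sub_add_cancel] at h2
    intro x
    rcases le_or_gt x a with hxa | hax
    · rw [hRa x hxa]
      positivity
    · rcases le_total x b with hxb | hbx
      · exact h1 x hax hxb
      · refine ((hRb x hbx).trans (hRb b le_rfl).symm).le.trans ((h1 b hab le_rfl).trans ?_)
        gcongr
  have hF' : ∀ x, F x =
      if x ≤ 1 / c then (N / (N + 1)) ^ N * (max (1 + c / N * x) 0) ^ N else 1 := by
    intro x
    have hx : 1 + c / N * x = (N + c * x) / N := by field_simp
    rw [hF]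
    by_cases h1 : x < -N / c
    · have h2 : x ≤ 1 / c := h1.le.trans (by gcongr; linarith)
      rw [lt_div_iff₀ hcpos] at h1
      have h3 : 1 + c / N * x ≤ 0 := by
        rw [hx]
        exact div_nonpos_of_nonpos_of_nonneg (by linarith) hN0.le
      rw [if_pos (by rwa [lt_div_iff₀ hcpos]), if_pos h2, max_eq_right h3,
        Real.zero_rpow hN0.ne', mul_zero]
    · rw [if_neg h1]
      rw [not_lt, div_le_iff₀ hcpos] at h1
      have h3 : 0 ≤ 1 + c / N * x := by
        rw [hx]
        exact div_nonneg (by linarith) hN0.le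
      rw [max_eq_left h3]
  have hL1 := integral_abs_sub_truncatedPower_le hN0 hcpos hε hab.le hRcont hRa hRb hR1 hRint
    (fun x => (htan x).trans (mul_le_mul_of_nonneg_right hclose (by positivity))) hF'
  obtain ⟨k, hk⟩ := exists_le_mul_exp_of_rpow_concaveOn hn hw hconc
    (by rwa [interior_Ioo]) hw0
  have hvar := one_le_twelve_mul_integral_sq (W := W) (k := k) (A := max (-a) b) hw0 hWnn
    (fun x => by
      by_cases hx : x ∈ Set.Ioo a b
      · rw [hWin x hx]; exact hk x hx
      · rw [hWout x hx]; positivity)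
    (fun x hx => hWout x fun h => by
      have := abs_lt.2 ⟨by linarith [h.1, le_max_left (-a) b], h.2.trans_le (le_max_right (-a) b)⟩
      linarith)
    hWint (hgint _ continuous_id) (hgint _ (continuous_pow 2)) hWmass
    ((hgval fun x => x).trans hbar)
  rw [hgval fun x => x ^ 2] at hvar
  set V := ∫ x in Set.Ioo a b, x ^ 2 * w x with hV
  have hsd : 1 ≤ 2 * Real.sqrt 3 * w 0 * V ^ ((1 : ℝ) / 2) := by
    have h1 : Real.sqrt (12 * w 0 ^ 2 * V) = 2 * Real.sqrt 3 * w 0 * V ^ ((1 : ℝ) / 2) := by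
      have h2 : 12 * w 0 ^ 2 * V = (2 * w 0) ^ 2 * (3 * V) := by ring
      rw [h2, Real.sqrt_mul (sq_nonneg _), Real.sqrt_sq (by positivity),
        Real.sqrt_mul (by norm_num), ← Real.sqrt_eq_rpow V]
      ring
    rw [← h1]
    exact Real.one_le_sqrt.2 hvar
  set δ := (1 + ε) ^ (-1 / N) with hδ
  have hδ1 : 0 ≤ 1 - δ := sub_nonneg.2 (Real.rpow_le_one_of_one_le_of_nonpos (by linarith)
    (div_nonpos_of_nonpos_of_nonneg (by norm_num) hN0.le))
  have hcinv : 1 / c ≤ (1 + ε) * (N / (N + 1)) ^ N *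
      (2 * Real.sqrt 3 * V ^ ((1 : ℝ) / 2)) := by
    have h1 : 1 / w 0 ≤ 2 * Real.sqrt 3 * V ^ ((1 : ℝ) / 2) := by
      rw [div_le_iff₀ hw0]; linarith
    have h2 : 1 / c = R 0 * (1 / w 0) := by rw [hc]; field_simp
    rw [h2]
    gcongr
  refine hL1.trans ?_
  calc 2 * N * (1 - δ) / c = 2 * N * (1 - δ) * (1 / c) := by ring
    _ ≤ 2 * N * (1 - δ) * ((1 + ε) * (N / (N + 1)) ^ N *
        (2 * Real.sqrt 3 * V ^ ((1 : ℝ) / 2))) := by gcongr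
    _ = _ := by
      rw [Real.div_rpow hN0.le (by positivity), Real.rpow_add hN0, Real.rpow_one]
      ring
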